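/- For the blow-up S_7 of ℙ² in 7 points in general position, Peyre's constant is α(S_7) = 1/30; that is, 8 · vol{x ∈ ℝ⁸ : B(E, x) ≥ 0 for every (−1)-class E, and 0 ≤ B(−K_7, x) ≤ 1} = 1/30, where vol is the standard Lebesgue measure on ℝ⁸. -/

import Mathlib

open scoped BigOperators
open MeasureTheory

/-- Intersection form on `ℤ^(n+1)` with basis `H, E₁, …, E_n`:
`B(x,y) = x₀y₀ - x₁y₁ - ⋯ - x_n y_n` (written as `2x₀y₀ - ∑ᵢ xᵢyᵢ`). -/
def interZ {n : ℕ} (x y : Fin (n + 1) → ℤ) : ℤ :=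
  2 * x 0 * y 0 - ∑ i, x i * y i

/-- The real intersection form on `ℝ^(n+1)`. -/
def interR {n : ℕ} (x y : Fin (n + 1) → ℝ) : ℝ :=
  2 * x 0 * y 0 - ∑ i, x i * y i

/-- The anticanonical class `-K = (3, -1, …, -1)`. -/
def antiK (n : ℕ) : Fin (n + 1) → ℤ := fun i => if i = 0 then 3 else -1

/-- The anticanonical class as a real vector. -/
def antiKR (n : ℕ) : Fin (n + 1) → ℝ := fun i => if i = 0 then 3 else -1

/-- A `(-1)`-class: `B(E,E) = -1` and `B(-K,E) = 1`. -/
def IsMinusOneClass {n : ℕ} (E : Fin (n + 1) → ℤ) : Prop :=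
  interZ E E = -1 ∧ interZ (antiK n) E = 1

/-- The nef cone: real vectors pairing nonnegatively with every `(-1)`-class. -/
def NefCone (n : ℕ) : Set (Fin (n + 1) → ℝ) :=
  {x | ∀ E : Fin (n + 1) → ℤ, IsMinusOneClass E → 0 ≤ interR (fun i => (E i : ℝ)) x}


instance {n : ℕ} (E : Fin (n + 1) → ℤ) : Decidable (IsMinusOneClass E) :=
  inferInstanceAs (Decidable (_ ∧ _))

/-- The integer vectors of length `n` all of whose entries are `c` or `c + 1`. -/
def cube (c : ℤ) : (n : ℕ) → List (Fin n → ℤ)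
  | 0 => [Fin.elim0]
  | n + 1 => (cube c n).flatMap fun v => [Fin.cons c v, Fin.cons (c + 1) v]

theorem mem_cube {c : ℤ} {n : ℕ} {v : Fin n → ℤ} (hv : ∀ i, v i = c ∨ v i = c + 1) :
    v ∈ cube c n := by
  induction n with
  | zero => simpa [cube] using Subsingleton.elim _ _
  | succ n ih =>
    rw [cube, List.mem_flatMap]
    refine ⟨Fin.tail v, ih fun i => hv i.succ, ?_⟩
    have h := Fin.cons_self_tail v
    rcases hv 0 with h0 | h0 <;> rw [h0] at h <;> simp [h]

/-- The list of `(-1)`-classes for `n ≤ 7` blown-up points. -/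
def classes (n : ℕ) : List (Fin (n + 1) → ℤ) :=
  ([(0, 0), (1, -1), (2, -1), (3, -2)] : List (ℤ × ℤ)).flatMap fun p =>
    ((cube p.2 n).map fun v => (Fin.cons p.1 v : Fin (n + 1) → ℤ)).filter
      fun E => decide (IsMinusOneClass E)

theorem interZ_antiK {n : ℕ} (E : Fin (n + 1) → ℤ) :
    interZ (antiK n) E = 3 * E 0 + ∑ i : Fin n, E i.succ := by
  simp [interZ, antiK, Fin.sum_univ_succ]
  ring

theorem interZ_self {n : ℕ} (E : Fin (n + 1) → ℤ) :
    interZ E E = E 0 ^ 2 - ∑ i : Fin n, E i.succ ^ 2 := by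
  simp only [interZ, Fin.sum_univ_succ, sq]
  ring

theorem mem_classes {n : ℕ} (hn : n ≤ 7) {E : Fin (n + 1) → ℤ} :
    E ∈ classes n ↔ IsMinusOneClass E := by
  constructor
  · intro h
    simp only [classes, List.mem_flatMap, List.mem_filter, decide_eq_true_eq] at h
    obtain ⟨_, _, _, h⟩ := h
    exact h
  · intro hE
    obtain ⟨h1, h2⟩ := id hE
    rw [interZ_self] at h1
    rw [interZ_antiK] at h2
    have hcs := sq_sum_le_card_mul_sum_sq (s := Finset.univ) (f := fun i : Fin n => E i.succ)
    have hn' : (n : ℤ) ≤ 7 := by exact_mod_cast hn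
    have hpoly : ∀ c : ℤ, ∑ i : Fin n, (E i.succ - c) * (E i.succ - (c + 1)) =
        (E 0 ^ 2 + 1) - (2 * c + 1) * (1 - 3 * E 0) + n * (c * (c + 1)) := by
      intro c
      have : ∀ i : Fin n, (E i.succ - c) * (E i.succ - (c + 1)) =
          E i.succ ^ 2 - (2 * c + 1) * E i.succ + c * (c + 1) := fun i => by ring
      simp only [this, Finset.sum_add_distrib, Finset.sum_sub_distrib, ← Finset.mul_sum,
        Finset.sum_const, Finset.card_univ, Fintype.card_fin, nsmul_eq_mul]
      linear_combination -h1 - (2 * c + 1) * h2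
    have hmem : ∀ c : ℤ, (E 0, c) ∈ ([(0, 0), (1, -1), (2, -1), (3, -2)] : List (ℤ × ℤ)) →
        (E 0 ^ 2 + 1) - (2 * c + 1) * (1 - 3 * E 0) + n * (c * (c + 1)) ≤ 0 →
        E ∈ classes n := by
      intro c hc hle
      rw [← hpoly] at hle
      have hnonneg : ∀ i : Fin n, 0 ≤ (E i.succ - c) * (E i.succ - (c + 1)) := by
        intro i
        rcases le_or_gt (E i.succ) c with h | h
        · exact mul_nonneg_of_nonpos_of_nonpos (by linarith) (by linarith)
        · exact mul_nonneg (by linarith) (by linarith [Int.add_one_le_of_lt h])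
      have hzero := (Finset.sum_eq_zero_iff_of_nonneg fun i _ => hnonneg i).1
        (le_antisymm hle (Finset.sum_nonneg fun i _ => hnonneg i))
      simp only [classes, List.mem_flatMap, List.mem_filter, decide_eq_true_eq, List.mem_map]
      refine ⟨_, hc, ⟨Fin.tail E, mem_cube fun i => ?_, Fin.cons_self_tail E⟩, hE⟩
      rcases mul_eq_zero.1 (hzero i (Finset.mem_univ i)) with h | h
      · exact Or.inl (sub_eq_zero.1 h)
      · exact Or.inr (sub_eq_zero.1 h)
    have hcs' : (1 - 3 * E 0) ^ 2 ≤ 7 * (E 0 ^ 2 + 1) := by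
      have hs : ∑ i : Fin n, E i.succ = 1 - 3 * E 0 := by linarith
      have hq : ∑ i : Fin n, E i.succ ^ 2 = E 0 ^ 2 + 1 := by linarith
      simp only [hs, hq, Finset.card_univ, Fintype.card_fin] at hcs
      nlinarith [sq_nonneg (E 0)]
    have ha : 0 ≤ E 0 := by nlinarith
    have hb : E 0 ≤ 3 := by nlinarith
    have hcases : E 0 = 0 ∨ E 0 = 1 ∨ E 0 = 2 ∨ E 0 = 3 := by omega
    rcases hcases with h | h | h | h
    · exact hmem 0 (by simp [h]) (by simp [h])
    · exact hmem (-1) (by simp [h]) (by simp [h])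
    · exact hmem (-1) (by simp [h]) (by simp [h])
    · exact hmem (-2) (by simp [h]) (by rw [h]; linarith)

/-- The class of the last exceptional curve. -/
def lastClass (n : ℕ) : Fin (n + 2) → ℤ := Fin.snoc 0 1

/-- Every class is joined to the last exceptional one by a path of pairwise disjoint classes. -/
def Linked (n : ℕ) : Prop :=
  ∀ E ∈ classes (n + 1), E = lastClass n ∨ interZ (lastClass n) E = 0 ∨
    (∃ F ∈ classes (n + 1), interZ (lastClass n) F = 0 ∧ interZ F E = 0) ∨
    (∃ F ∈ classes (n + 1), interZ (lastClass n) F = 0 ∧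
      ∃ G ∈ classes (n + 1), interZ F G = 0 ∧ interZ G E = 0)

/-- Every class pushes down to a sum of at most three classes. -/
def PushesDown (n : ℕ) : Prop :=
  ∀ E ∈ classes (n + 1), Fin.init E = 0 ∨ IsMinusOneClass (Fin.init E) ∨
    (∃ F ∈ classes n, IsMinusOneClass (Fin.init E - F)) ∨
    (∃ F ∈ classes n, ∃ G ∈ classes n, IsMinusOneClass (Fin.init E - F - G))

instance (n : ℕ) : Decidable (Linked n) := by unfold Linked; infer_instance

instance (n : ℕ) : Decidable (PushesDown n) := by unfold PushesDown; infer_instance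

theorem lintegral_Ioc_one_add_mul_pow (m : ℕ) {d : ℝ} (hd : 0 < d) :
    ∫⁻ s in Set.Ioc (-(1 / d)) 0, ENNReal.ofReal ((1 + d * s) ^ m) =
      ENNReal.ofReal (1 / (d * (m + 1))) := by
  have hle : -(1 / d) ≤ 0 := by
    rw [neg_nonpos]
    positivity
  rw [← ofReal_integral_eq_lintegral_ofReal, ← intervalIntegral.integral_of_le hle]
  · congr 1
    have h := intervalIntegral.integral_comp_mul_add (a := -(1 / d)) (b := 0)
      (fun x : ℝ => x ^ m) hd.ne' 1
    simp only [add_comm _ (1 : ℝ)] at h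
    rw [h, integral_pow]
    have : (1 : ℝ) + d * -(1 / d) = 0 := by
      field_simp
      ring
    rw [this]
    simp
    ring
  · exact (Continuous.integrableOn_Icc (by fun_prop)).mono_set Set.Ioc_subset_Icc_self
  · refine (ae_restrict_iff' measurableSet_Ioc).2 (Filter.Eventually.of_forall fun s hs => ?_)
    have h1 : 0 ≤ 1 + d * s := by
      have := mul_le_mul_of_nonneg_left hs.1.le hd.le
      have h2 : d * -(1 / d) = -1 := by field_simp
      linarith
    exact pow_nonneg h1 m

open scoped Pointwise in
/-- The sublevel set at height `r` of a linear form on a cone scales like `r ^ m`. -/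
theorem volume_cone_sublevel {m : ℕ} {K : Set (Fin m → ℝ)}
    (hK : ∀ c : ℝ, 0 < c → ∀ x ∈ K, c • x ∈ K) (φ : (Fin m → ℝ) →ₗ[ℝ] ℝ) {r : ℝ} (hr : 0 < r) :
    volume {x | x ∈ K ∧ φ x ≤ r} = ENNReal.ofReal (r ^ m) * volume {x | x ∈ K ∧ φ x ≤ 1} := by
  have hset : {x | x ∈ K ∧ φ x ≤ r} = r • {x | x ∈ K ∧ φ x ≤ 1} := by
    ext x
    rw [Set.mem_smul_set_iff_inv_smul_mem₀ hr.ne']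
    simp only [Set.mem_ofPred_eq, map_smul, smul_eq_mul]
    refine and_congr ⟨fun h => hK _ (inv_pos.2 hr) _ h, fun h => ?_⟩ ?_
    · simpa [smul_smul, hr.ne'] using hK r hr _ h
    · rw [inv_mul_le_iff₀ hr, mul_one]
  rw [hset, Measure.addHaar_smul, Module.finrank_fin_fun, abs_of_pos (pow_pos hr m)]

/-- The volume of a truncated cone spanned by a cone `K` in the hyperplane where the last
coordinate vanishes and one further ray, through a point with last coordinate `-1`. -/
theorem volume_cone_join {m : ℕ} {K : Set (Fin m → ℝ)} (hKc : IsClosed K)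
    (hK : ∀ c : ℝ, 0 < c → ∀ x ∈ K, c • x ∈ K) (φ : (Fin m → ℝ) →ₗ[ℝ] ℝ)
    (hφ : ∀ x ∈ K, 0 ≤ φ x) (k : Fin m → ℝ) {d : ℝ} (hd : 0 < d) :
    volume {x : Fin (m + 1) → ℝ | x (Fin.last m) ≤ 0 ∧ Fin.init x + x (Fin.last m) • k ∈ K ∧
        φ (Fin.init x + x (Fin.last m) • k) ≤ 1 + d * x (Fin.last m)} =
      volume {x | x ∈ K ∧ φ x ≤ 1} * ENNReal.ofReal (1 / (d * (m + 1))) := by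
  have hφc : Continuous φ := φ.continuous_of_finiteDimensional
  set T : Set (ℝ × (Fin m → ℝ)) :=
    {p | p.1 ≤ 0 ∧ p.2 + p.1 • k ∈ K ∧ φ (p.2 + p.1 • k) ≤ 1 + d * p.1} with hT
  have hTm : MeasurableSet T := by
    refine IsClosed.measurableSet ?_
    have hlin : Continuous fun p : ℝ × (Fin m → ℝ) => p.2 + p.1 • k := by fun_prop
    exact (isClosed_le continuous_fst continuous_const).inter ((hKc.preimage hlin).inter
      (isClosed_le (hφc.comp hlin) (continuous_const.add (continuous_const.mul continuous_fst))))
  have hpre := (volume_preserving_piFinSuccAbove (fun _ : Fin (m + 1) => ℝ)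
    (Fin.last m)).measure_preimage hTm.nullMeasurableSet
  have hset : (MeasurableEquiv.piFinSuccAbove (fun _ : Fin (m + 1) => ℝ) (Fin.last m)) ⁻¹' T =
      {x : Fin (m + 1) → ℝ | x (Fin.last m) ≤ 0 ∧ Fin.init x + x (Fin.last m) • k ∈ K ∧
        φ (Fin.init x + x (Fin.last m) • k) ≤ 1 + d * x (Fin.last m)} := by
    ext x
    have h2 : (MeasurableEquiv.piFinSuccAbove (fun _ : Fin (m + 1) => ℝ) (Fin.last m)) x =
        (x (Fin.last m), Fin.init x) := by
      refine Prod.ext rfl (funext fun i => ?_)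
      simp [MeasurableEquiv.piFinSuccAbove, Fin.init]
    rw [Set.mem_preimage, h2]
    rfl
  have hslice : ∀ᵐ s : ℝ, volume (Prod.mk s ⁻¹' T) =
      (Set.Ioc (-(1 / d)) 0).indicator (fun s => ENNReal.ofReal ((1 + d * s) ^ m) *
        volume {x | x ∈ K ∧ φ x ≤ 1}) s := by
    have hne : ∀ᵐ s : ℝ, s ≠ -(1 / d) := by simp [ae_iff]
    filter_upwards [hne] with s hs
    have hdd : d * -(1 / d) = -1 := by field_simp
    by_cases hmem : s ∈ Set.Ioc (-(1 / d)) 0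
    · rw [Set.indicator_of_mem hmem]
      have hr : 0 < 1 + d * s := by
        have := mul_lt_mul_of_pos_left hmem.1 hd
        linarith
      rw [← volume_cone_sublevel hK φ hr, ← measure_preimage_add_right volume (s • k)
        {x | x ∈ K ∧ φ x ≤ 1 + d * s}]
      congr 1
      ext y
      exact and_iff_right hmem.2
    · rw [Set.indicator_of_notMem hmem]
      have : Prod.mk s ⁻¹' T = ∅ := by
        refine Set.eq_empty_of_forall_notMem fun y hy => hmem ⟨?_, hy.1⟩
        have h0 := (hφ _ hy.2.1).trans hy.2.2
        refine lt_of_le_of_ne ?_ hs.symm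
        by_contra! hlt
        have := mul_lt_mul_of_pos_left hlt hd
        simp only at h0
        linarith
      rw [this, measure_empty]
  rw [← hset, hpre, Measure.volume_eq_prod, Measure.prod_apply hTm, lintegral_congr_ae hslice,
    lintegral_indicator measurableSet_Ioc, lintegral_mul_const _ (by fun_prop),
    lintegral_Ioc_one_add_mul_pow m hd, mul_comm]

section IntersectionForm

variable {n : ℕ}

theorem interR_comm (x y : Fin (n + 1) → ℝ) : interR x y = interR y x := by
  simp only [interR, mul_comm, mul_left_comm]

/-- Intersection with a fixed real class, as a linear form. -/
def interL (v : Fin (n + 1) → ℝ) : (Fin (n + 1) → ℝ) →ₗ[ℝ] ℝ where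
  toFun := interR v
  map_add' x y := by
    simp only [interR, Pi.add_apply, mul_add, Finset.sum_add_distrib]
    ring
  map_smul' c x := by
    simp only [interR, Pi.smul_apply, smul_eq_mul, mul_left_comm _ c, ← Finset.mul_sum,
      RingHom.id_apply]
    ring

theorem interR_add_right (v x y : Fin (n + 1) → ℝ) :
    interR v (x + y) = interR v x + interR v y := (interL v).map_add x y

theorem interR_smul_right (c : ℝ) (v x : Fin (n + 1) → ℝ) :
    interR v (c • x) = c * interR v x := (interL v).map_smul c x

theorem interR_sub_right (v x y : Fin (n + 1) → ℝ) :
    interR v (x - y) = interR v x - interR v y := (interL v).map_sub x y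

theorem interR_add_left (x y v : Fin (n + 1) → ℝ) :
    interR (x + y) v = interR x v + interR y v := by
  simp only [interR_comm _ v, interR_add_right]

theorem interR_sub_left (x y v : Fin (n + 1) → ℝ) :
    interR (x - y) v = interR x v - interR y v := by
  simp only [interR_comm _ v, interR_sub_right]

theorem interR_smul_left (c : ℝ) (x v : Fin (n + 1) → ℝ) :
    interR (c • x) v = c * interR x v := by
  simp only [interR_comm _ v, interR_smul_right]

theorem continuous_interR (v : Fin (n + 1) → ℝ) : Continuous (interR v) := by
  unfold interR
  fun_prop

/-- The real class underlying an integral class. -/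
def toR (E : Fin (n + 1) → ℤ) : Fin (n + 1) → ℝ := fun i => (E i : ℝ)

theorem toR_add (E F : Fin (n + 1) → ℤ) : toR (E + F) = toR E + toR F := by
  ext; simp [toR]

theorem toR_sub (E F : Fin (n + 1) → ℤ) : toR (E - F) = toR E - toR F := by
  ext; simp [toR]

theorem toR_zsmul (c : ℤ) (E : Fin (n + 1) → ℤ) : toR (c • E) = (c : ℝ) • toR E := by
  ext; simp [toR]

theorem toR_antiK : toR (antiK n) = antiKR n := by
  ext i
  simp only [toR, antiK, antiKR]
  split_ifs <;> simp

theorem interR_toR (E F : Fin (n + 1) → ℤ) : interR (toR E) (toR F) = interZ E F := by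
  simp [interR, interZ, toR]

theorem interZ_comm (x y : Fin (n + 1) → ℤ) : interZ x y = interZ y x := by
  simp only [interZ, mul_comm, mul_left_comm]

theorem interZ_add_right (v x y : Fin (n + 1) → ℤ) :
    interZ v (x + y) = interZ v x + interZ v y := by
  simp only [interZ, Pi.add_apply, mul_add, Finset.sum_add_distrib]
  ring

theorem interZ_smul_right (c : ℤ) (v x : Fin (n + 1) → ℤ) :
    interZ v (c • x) = c * interZ v x := by
  simp only [interZ, Pi.smul_apply, smul_eq_mul, mul_left_comm _ c, ← Finset.mul_sum]
  ring

theorem interZ_sub_right (v x y : Fin (n + 1) → ℤ) :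
    interZ v (x - y) = interZ v x - interZ v y := by
  rw [sub_eq_add_neg, ← neg_one_smul ℤ y, interZ_add_right, interZ_smul_right]
  ring

theorem mem_nefCone {x : Fin (n + 1) → ℝ} :
    x ∈ NefCone n ↔ ∀ E : Fin (n + 1) → ℤ, IsMinusOneClass E → 0 ≤ interR (toR E) x :=
  Iff.rfl

theorem isClosed_nefCone : IsClosed (NefCone n) := by
  simp only [NefCone, Set.ofPred_forall]
  exact isClosed_iInter fun E => isClosed_iInter fun _ =>
    isClosed_le continuous_const (continuous_interR _)

theorem smul_mem_nefCone {c : ℝ} (hc : 0 < c) {x : Fin (n + 1) → ℝ} (hx : x ∈ NefCone n) :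
    c • x ∈ NefCone n := by
  intro E hE
  rw [interR_smul_right]
  exact mul_nonneg hc.le (hx E hE)

theorem interR_nonneg_of_list_sum {L : List (Fin (n + 1) → ℤ)} (hL : ∀ E ∈ L, IsMinusOneClass E)
    {x : Fin (n + 1) → ℝ} (hx : x ∈ NefCone n) : 0 ≤ interR (toR L.sum) x := by
  induction L with
  | nil => simp [interR, toR]
  | cons E L ih =>
    rw [List.sum_cons, toR_add, interR_add_left]
    exact add_nonneg (hx E (hL E (by simp))) (ih fun F hF => hL F (by simp [hF]))

theorem degree_nonneg {L : List (Fin (n + 1) → ℤ)} (hL : ∀ E ∈ L, IsMinusOneClass E)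
    {c : ℤ} (hc : 0 < c) (hsum : L.sum = c • antiK n) {x : Fin (n + 1) → ℝ}
    (hx : x ∈ NefCone n) : 0 ≤ interR (antiKR n) x := by
  have h := interR_nonneg_of_list_sum hL hx
  rw [hsum, toR_zsmul, toR_antiK, interR_smul_left] at h
  exact nonneg_of_mul_nonneg_right h (by exact_mod_cast hc)

/-- The nef classes of degree at most one. -/
def nefPolytope (n : ℕ) : Set (Fin (n + 1) → ℝ) :=
  {x | x ∈ NefCone n ∧ interR (antiKR n) x ≤ 1}

/-- The part of the nef polytope where `E` has minimal degree among all `(-1)`-classes. -/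
def minRegion (E : Fin (n + 1) → ℤ) : Set (Fin (n + 1) → ℝ) :=
  {x | x ∈ nefPolytope n ∧ ∀ F : Fin (n + 1) → ℤ, IsMinusOneClass F →
    interR (toR E) x ≤ interR (toR F) x}

theorem isClosed_minRegion (E : Fin (n + 1) → ℤ) : IsClosed (minRegion E) := by
  have hset : minRegion E = (NefCone n ∩ {x | interR (antiKR n) x ≤ 1}) ∩
      ⋂ (F : Fin (n + 1) → ℤ) (_ : IsMinusOneClass F),
        {x | interR (toR E) x ≤ interR (toR F) x} := by
    ext x
    simp [minRegion, nefPolytope]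
  rw [hset]
  exact (isClosed_nefCone.inter (isClosed_le (continuous_interR _) continuous_const)).inter
    (isClosed_iInter fun F => isClosed_iInter fun _ =>
      isClosed_le (continuous_interR _) (continuous_interR _))

/-- The reflection in a class `v` of self-intersection `-2`. -/
def reflect (v : Fin (n + 1) → ℝ) : (Fin (n + 1) → ℝ) →ₗ[ℝ] (Fin (n + 1) → ℝ) :=
  LinearMap.id + (interL v).smulRight v

theorem reflect_apply (v x : Fin (n + 1) → ℝ) : reflect v x = x + interR v x • v := rfl

theorem interR_reflect (v x y : Fin (n + 1) → ℝ) :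
    interR y (reflect v x) = interR (reflect v y) x := by
  rw [reflect_apply, reflect_apply, interR_add_right, interR_add_left, interR_smul_right,
    interR_smul_left, interR_comm y v]
  ring

theorem volume_preimage_reflect {v : Fin (n + 1) → ℝ} (hv : interR v v = -2)
    (s : Set (Fin (n + 1) → ℝ)) : volume (reflect v ⁻¹' s) = volume s := by
  have hinv : reflect v ∘ₗ reflect v = LinearMap.id := by
    refine LinearMap.ext fun x => ?_
    simp only [LinearMap.comp_apply, reflect_apply, interR_add_right, interR_smul_right, hv,
      LinearMap.id_apply]
    module
  have hdet : LinearMap.det (reflect v) * LinearMap.det (reflect v) = 1 := by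
    rw [← LinearMap.det_comp, hinv, LinearMap.det_id]
  have habs : |LinearMap.det (reflect v)| = 1 := by
    rcases mul_self_eq_one_iff.1 hdet with h | h <;> simp [h]
  rw [Measure.addHaar_preimage_linearMap _ (left_ne_zero_of_mul_eq_one hdet), abs_inv, habs]
  simp

theorem volume_minRegion_le {E F : Fin (n + 1) → ℤ} (hE : IsMinusOneClass E)
    (hF : IsMinusOneClass F) (hEF : interZ E F = 0) :
    volume (minRegion F) ≤ volume (minRegion E) := by
  set w := E - F with hw
  have hFE : interZ F E = 0 := by rw [interZ_comm, hEF]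
  have hwE : interZ w E = -1 := by
    rw [interZ_comm, hw, interZ_sub_right, hE.1, hEF]
    norm_num
  have hwF : interZ w F = 1 := by
    rw [interZ_comm, hw, interZ_sub_right, hF.1, hFE]
    norm_num
  have hww : interZ w w = -2 := by
    nth_rw 2 [hw]
    rw [interZ_sub_right, hwE, hwF]
    norm_num
  have hKw : interZ (antiK n) w = 0 := by
    rw [hw, interZ_sub_right, hE.2, hF.2, sub_self]
  have hv : interR (toR w) (toR w) = -2 := by
    rw [interR_toR, hww]
    norm_num
  have hclass : ∀ G : Fin (n + 1) → ℤ, reflect (toR w) (toR G) = toR (G + interZ w G • w) := by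
    intro G
    rw [reflect_apply, interR_toR, toR_add, toR_zsmul]
  have hminus : ∀ G : Fin (n + 1) → ℤ, IsMinusOneClass G →
      IsMinusOneClass (G + interZ w G • w) := by
    intro G hG
    constructor
    · rw [interZ_add_right, interZ_smul_right, interZ_comm _ G, interZ_comm _ w,
        interZ_add_right, interZ_add_right, interZ_smul_right, interZ_smul_right, hww, hG.1,
        interZ_comm G w]
      ring
    · rw [interZ_add_right, interZ_smul_right, hKw, hG.2]
      ring
  have hEF' : reflect (toR w) (toR E) = toR F := by
    rw [hclass, hwE, hw]
    congr 1
    simp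
  have hK : reflect (toR w) (antiKR n) = antiKR n := by
    rw [← toR_antiK, hclass, interZ_comm, hKw, zero_smul, add_zero]
  rw [← volume_preimage_reflect hv (minRegion E)]
  refine measure_mono fun x hx => ⟨⟨fun G hG => ?_, ?_⟩, fun G hG => ?_⟩
  · change 0 ≤ interR (toR G) _
    rw [interR_reflect, hclass]
    exact hx.1.1 _ (hminus G hG)
  · rw [interR_reflect, hK]
    exact hx.1.2
  · rw [interR_reflect, interR_reflect, hEF', hclass]
    exact hx.2 _ (hminus G hG)

theorem volume_minRegion_eq {E F : Fin (n + 1) → ℤ} (hE : IsMinusOneClass E)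
    (hF : IsMinusOneClass F) (hEF : interZ E F = 0) :
    volume (minRegion F) = volume (minRegion E) :=
  le_antisymm (volume_minRegion_le hE hF hEF)
    (volume_minRegion_le hF hE (by rw [interZ_comm, hEF]))

theorem aedisjoint_minRegion {E F : Fin (n + 1) → ℤ} (hE : IsMinusOneClass E)
    (hF : IsMinusOneClass F) (hne : E ≠ F) : AEDisjoint volume (minRegion E) (minRegion F) := by
  have hker : volume ((LinearMap.ker (interL (toR E - toR F)) : Submodule ℝ _) :
      Set (Fin (n + 1) → ℝ)) = 0 := by
    refine Measure.addHaar_submodule _ _ fun htop => hne ?_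
    have hzero : ∀ x, interR (toR E - toR F) x = 0 := fun x =>
      LinearMap.mem_ker.1 (htop ▸ Submodule.mem_top : x ∈ LinearMap.ker (interL (toR E - toR F)))
    ext i
    have h := hzero (Pi.single i 1)
    have h0 := hzero (Pi.single 0 1)
    simp only [interR, Pi.sub_apply, toR, Pi.single_apply, mul_ite, mul_one, mul_zero,
      Finset.sum_ite_eq', Finset.mem_univ, if_true] at h h0
    have h0' : (E 0 : ℝ) = F 0 := by linarith
    rw [h0'] at h
    have : (E i : ℝ) = F i := by
      split_ifs at h <;> linarith
    exact_mod_cast this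
  refine measure_mono_null (fun x hx => ?_) hker
  change interR (toR E - toR F) x = 0
  rw [interR_sub_left, sub_eq_zero]
  exact le_antisymm (hx.1.2 F hF) (hx.2.2 E hE)

theorem volume_nefPolytope_eq_card_mul {C : List (Fin (n + 1) → ℤ)} (hnd : C.Nodup)
    (hne : C ≠ []) (hC : ∀ E, E ∈ C ↔ IsMinusOneClass E) {a : ENNReal}
    (ha : ∀ E ∈ C, volume (minRegion E) = a) : volume (nefPolytope n) = C.length * a := by
  classical
  have hunion : nefPolytope n = ⋃ E ∈ C.toFinset, minRegion E := by
    ext x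
    simp only [Set.mem_iUnion, List.mem_toFinset, exists_prop]
    constructor
    · intro hx
      obtain ⟨E, hE, hmin⟩ := C.toFinset.exists_min_image (fun E => interR (toR E) x)
        (by simpa [List.toFinset_nonempty_iff] using hne)
      exact ⟨E, List.mem_toFinset.1 hE, hx, fun F hF =>
        hmin F (List.mem_toFinset.2 ((hC F).2 hF))⟩
    · rintro ⟨E, -, hx⟩
      exact hx.1
  rw [hunion, measure_biUnion_finset₀]
  · rw [Finset.sum_congr rfl fun E hE => ha E (List.mem_toFinset.1 hE), Finset.sum_const,
      List.toFinset_card_of_nodup hnd, nsmul_eq_mul]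
  · intro E hE F hF hEF
    simp only [List.coe_toFinset, Set.mem_ofPred_eq] at hE hF
    exact aedisjoint_minRegion ((hC E).1 hE) ((hC F).1 hF) hEF
  · exact fun E _ => (isClosed_minRegion E).nullMeasurableSet

end IntersectionForm

section Recursion

variable {n : ℕ}

theorem interR_eq_init (v x : Fin (n + 2) → ℝ) :
    interR v x =
      interR (Fin.init v) (Fin.init x) - v (Fin.last (n + 1)) * x (Fin.last (n + 1)) := by
  simp only [interR, Fin.sum_univ_castSucc (n := n + 1), Fin.init, Fin.castSucc_zero]
  ring

theorem interZ_eq_init (v x : Fin (n + 2) → ℤ) :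
    interZ v x =
      interZ (Fin.init v) (Fin.init x) - v (Fin.last (n + 1)) * x (Fin.last (n + 1)) := by
  simp only [interZ, Fin.sum_univ_castSucc (n := n + 1), Fin.init, Fin.castSucc_zero]
  ring

theorem init_antiK : (Fin.init (antiK (n + 1)) : Fin (n + 1) → ℤ) = antiK n := by
  ext i
  simp [Fin.init, antiK]

theorem antiK_last : antiK (n + 1) (Fin.last (n + 1)) = -1 := by
  simp [antiK, Fin.ext_iff]

theorem interZ_antiK_antiK : interZ (antiK n) (antiK n) = 9 - n := by
  rw [interZ_antiK]
  simp [antiK]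
  ring

theorem isMinusOneClass_snoc_zero {F : Fin (n + 1) → ℤ} (hF : IsMinusOneClass F) :
    IsMinusOneClass (n := n + 1) (Fin.snoc F 0 : Fin (n + 2) → ℤ) := by
  constructor
  · rw [interZ_eq_init, Fin.init_snoc, Fin.snoc_last, hF.1]
    norm_num
  · rw [interZ_eq_init, Fin.init_snoc, Fin.snoc_last, init_antiK, hF.2]
    norm_num

theorem isMinusOneClass_lastClass : IsMinusOneClass (n := n + 1) (lastClass n) := by
  constructor
  · rw [interZ_eq_init, lastClass, Fin.init_snoc, Fin.snoc_last]
    simp [interZ]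
  · rw [interZ_eq_init, lastClass, Fin.init_snoc, Fin.snoc_last, antiK_last]
    simp [interZ]

theorem interR_class_eq {E : Fin (n + 2) → ℤ} (hE : IsMinusOneClass (n := n + 1) E)
    (x : Fin (n + 2) → ℝ) :
    interR (toR E) x = interR (toR (Fin.init E : Fin (n + 1) → ℤ))
      (Fin.init x + x (Fin.last (n + 1)) • antiKR n) - x (Fin.last (n + 1)) := by
  have h := hE.2
  rw [interZ_eq_init, init_antiK, antiK_last, interZ_comm] at h
  have h' : (interZ (Fin.init E) (antiK n) : ℝ) = 1 - E (Fin.last (n + 1)) := by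
    exact_mod_cast (by linarith : interZ (Fin.init E) (antiK n) = 1 - E (Fin.last (n + 1)))
  rw [interR_eq_init, interR_add_right, interR_smul_right, ← toR_antiK, interR_toR, h']
  change interR (toR (Fin.init E)) _ - (E (Fin.last (n + 1)) : ℝ) * _ = _
  ring

theorem interR_antiKR_eq (x : Fin (n + 2) → ℝ) :
    interR (antiKR (n + 1)) x = interR (antiKR n)
      (Fin.init x + x (Fin.last (n + 1)) • antiKR n) - (8 - n) * x (Fin.last (n + 1)) := by
  have hinit : (Fin.init (antiKR (n + 1)) : Fin (n + 1) → ℝ) = antiKR n := by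
    ext i
    simp [Fin.init, antiKR]
  have hlast : antiKR (n + 1) (Fin.last (n + 1)) = -1 := by
    simp [antiKR, Fin.ext_iff]
  have hself : interR (antiKR n) (antiKR n) = 9 - n := by
    rw [← toR_antiK, interR_toR, interZ_antiK_antiK]
    push_cast
    ring
  rw [interR_eq_init, interR_add_right, interR_smul_right, hinit, hlast, hself]
  ring

theorem interR_init_nonneg (hn : n + 1 ≤ 7) (hp : PushesDown n) {E : Fin (n + 2) → ℤ}
    (hE : IsMinusOneClass (n := n + 1) E) {y : Fin (n + 1) → ℝ} (hy : y ∈ NefCone n) :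
    0 ≤ interR (toR (Fin.init E : Fin (n + 1) → ℤ)) y := by
  rcases hp E ((mem_classes hn).2 hE) with h | h | ⟨F, hF, h⟩ | ⟨F, hF, G, hG, h⟩
  · rw [h]
    simp [interR, toR]
  · exact hy _ h
  · have h1 := mem_nefCone.1 hy _ h
    have h2 := mem_nefCone.1 hy _ ((mem_classes (by omega)).1 hF)
    rw [toR_sub, interR_sub_left] at h1
    linarith
  · have h1 := mem_nefCone.1 hy _ h
    have h2 := mem_nefCone.1 hy _ ((mem_classes (by omega)).1 hF)
    have h3 := mem_nefCone.1 hy _ ((mem_classes (by omega)).1 hG)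
    rw [toR_sub, toR_sub, interR_sub_left, interR_sub_left] at h1
    linarith

theorem volume_minRegion_lastClass (hn : n + 1 ≤ 7) (hp : PushesDown n)
    (hdeg : ∀ y ∈ NefCone n, 0 ≤ interR (antiKR n) y) :
    volume (minRegion (n := n + 1) (lastClass n)) =
      volume (nefPolytope n) * ENNReal.ofReal (1 / ((8 - n) * (n + 2))) := by
  have hd : (0 : ℝ) < 8 - n := by
    have : (n : ℝ) + 1 ≤ 7 := by exact_mod_cast hn
    linarith
  have hjoin := volume_cone_join (m := n + 1) isClosed_nefCone
    (fun c hc x hx => smul_mem_nefCone hc hx) (interL (antiKR n)) hdeg (antiKR n) hd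
  have hcast : (((n + 1 : ℕ) : ℝ) + 1) = n + 2 := by
    push_cast
    ring
  rw [hcast] at hjoin
  refine Eq.trans (congrArg _ (Set.ext fun x => ?_)) hjoin
  have hlast : interR (toR (lastClass n)) x = -x (Fin.last (n + 1)) := by
    have hinit : (Fin.init (lastClass n) : Fin (n + 1) → ℤ) = 0 := by
      rw [lastClass, Fin.init_snoc]
    rw [interR_class_eq isMinusOneClass_lastClass, hinit]
    simp [interR, toR]
  have hφ : ∀ y, interL (antiKR n) y = interR (antiKR n) y := fun _ => rfl
  simp only [minRegion, nefPolytope, Set.mem_ofPred_eq, hlast, interR_antiKR_eq, hφ]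
  constructor
  · rintro ⟨⟨hnef, hle⟩, hmin⟩
    refine ⟨?_, fun F hF => ?_, by linarith⟩
    · have := mem_nefCone.1 hnef _ isMinusOneClass_lastClass
      linarith
    · have h := hmin _ (isMinusOneClass_snoc_zero hF)
      rw [interR_class_eq (isMinusOneClass_snoc_zero hF), Fin.init_snoc] at h
      change 0 ≤ interR (toR F) _
      linarith
  · rintro ⟨hs, hnef, hle⟩
    have hmin : ∀ F : Fin (n + 2) → ℤ, IsMinusOneClass (n := n + 1) F →
        -x (Fin.last (n + 1)) ≤ interR (toR F) x := by
      intro F hF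
      rw [interR_class_eq hF]
      have := interR_init_nonneg hn hp hF hnef
      linarith
    refine ⟨⟨fun F hF => ?_, by linarith⟩, hmin⟩
    have := hmin F hF
    change 0 ≤ interR (toR F) x
    linarith

theorem volume_minRegion_eq_lastClass (hn : n + 1 ≤ 7) (hl : Linked n) {E : Fin (n + 2) → ℤ}
    (hE : E ∈ classes (n + 1)) :
    volume (minRegion (n := n + 1) E) = volume (minRegion (n := n + 1) (lastClass n)) := by
  have hc : ∀ {F : Fin (n + 2) → ℤ}, F ∈ classes (n + 1) → IsMinusOneClass (n := n + 1) F :=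
    fun hF => (mem_classes hn).1 hF
  have h0 : IsMinusOneClass (n := n + 1) (lastClass n) := isMinusOneClass_lastClass
  rcases hl E hE with h | h | ⟨F, hF, h1, h2⟩ | ⟨F, hF, h1, G, hG, h2, h3⟩
  · rw [h]
  · exact volume_minRegion_eq h0 (hc hE) h
  · exact (volume_minRegion_eq (hc hF) (hc hE) h2).trans (volume_minRegion_eq h0 (hc hF) h1)
  · exact (volume_minRegion_eq (hc hG) (hc hE) h3).trans
      ((volume_minRegion_eq (hc hF) (hc hG) h2).trans (volume_minRegion_eq h0 (hc hF) h1))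

theorem volume_nefPolytope_succ (hn : n + 1 ≤ 7) (hp : PushesDown n) (hl : Linked n)
    (hdeg : ∀ y ∈ NefCone n, 0 ≤ interR (antiKR n) y) (hnd : (classes (n + 1)).Nodup)
    (hne : classes (n + 1) ≠ []) {a : ℝ} (ha : 0 ≤ a)
    (hvol : volume (nefPolytope n) = ENNReal.ofReal a) :
    volume (nefPolytope (n + 1)) =
      ENNReal.ofReal ((classes (n + 1)).length * (a * (1 / ((8 - n) * (n + 2))))) := by
  rw [volume_nefPolytope_eq_card_mul hnd hne (fun E => mem_classes hn)
    fun E hE => volume_minRegion_eq_lastClass hn hl hE, volume_minRegion_lastClass hn hp hdeg,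
    hvol, ENNReal.ofReal_mul (Nat.cast_nonneg _), ENNReal.ofReal_mul ha, ENNReal.ofReal_natCast]

end Recursion

theorem mem_nefCone_two {x : Fin 3 → ℝ} :
    x ∈ NefCone 2 ↔ x 1 ≤ 0 ∧ x 2 ≤ 0 ∧ 0 ≤ x 0 + x 1 + x 2 := by
  have hlist : classes 2 = [![0, 1, 0], ![0, 0, 1], ![1, -1, -1]] := by decide +kernel
  have hmem : ∀ E : Fin 3 → ℤ, IsMinusOneClass (n := 2) E ↔
      E = ![0, 1, 0] ∨ E = ![0, 0, 1] ∨ E = ![1, -1, -1] := by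
    intro E
    rw [← mem_classes (by norm_num), hlist]
    simp
  have hR : ∀ v : Fin 3 → ℝ, interR (n := 2) v x =
      2 * v 0 * x 0 - (v 0 * x 0 + v 1 * x 1 + v 2 * x 2) := fun v => by
    rw [interR, Fin.sum_univ_three]
  simp only [mem_nefCone, hmem, forall_eq_or_imp, forall_eq, hR, toR, Matrix.cons_val]
  push_cast
  constructor
  · rintro ⟨h1, h2, h3⟩
    exact ⟨by linarith, by linarith, by linarith⟩
  · rintro ⟨h1, h2, h3⟩
    exact ⟨by linarith, by linarith, by linarith⟩

theorem interR_antiKR_two (x : Fin 3 → ℝ) : interR (antiKR 2) x = 3 * x 0 + x 1 + x 2 := by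
  rw [interR, Fin.sum_univ_three]
  simp [antiKR]
  ring

theorem volume_nefPolytope_two : volume (nefPolytope 2) = ENNReal.ofReal (1 / 72) := by
  obtain ⟨φ, hφ⟩ : ∃ φ : (Fin 1 → ℝ) →ₗ[ℝ] ℝ, ∀ x, φ x = 3 * x 0 :=
    ⟨(3 : ℝ) • LinearMap.proj 0, fun _ => rfl⟩
  obtain ⟨ψ, hψ⟩ : ∃ ψ : (Fin 2 → ℝ) →ₗ[ℝ] ℝ, ∀ x, ψ x = 3 * x 0 + x 1 :=
    ⟨(3 : ℝ) • LinearMap.proj 0 + LinearMap.proj 1, fun _ => rfl⟩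
  have hzero : volume {x : Fin 1 → ℝ | x ∈ {x : Fin 1 → ℝ | 0 ≤ x 0} ∧ φ x ≤ 1} =
      ENNReal.ofReal (1 / 3) := by
    have hIcc : {x : Fin 1 → ℝ | x ∈ {x : Fin 1 → ℝ | 0 ≤ x 0} ∧ φ x ≤ 1} =
        Set.Icc (fun _ => 0) (fun _ => 1 / 3) := by
      ext x
      simp only [Set.mem_ofPred_eq, hφ, Set.mem_Icc, Pi.le_def, Fin.forall_fin_one]
      refine and_congr_right fun _ => ?_
      constructor <;> intro h <;> linarith
    rw [hIcc, Real.volume_Icc_pi]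
    simp
  have hone := volume_cone_join (m := 1) (K := {x : Fin 1 → ℝ | 0 ≤ x 0})
    (isClosed_le continuous_const (continuous_apply 0))
    (fun c hc x hx => mul_nonneg hc.le hx) φ
    (fun x hx => by
      rw [hφ]
      exact mul_nonneg (by norm_num) hx) ![1] (d := 2) (by norm_num)
  rw [hzero] at hone
  have htwo := volume_cone_join (m := 2) (K := {x : Fin 2 → ℝ | x 1 ≤ 0 ∧ 0 ≤ x 0 + x 1})
    ((isClosed_le (continuous_apply 1) continuous_const).inter
      (isClosed_le continuous_const ((continuous_apply 0).add (continuous_apply 1))))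
    (fun c hc x hx => ⟨mul_nonpos_of_nonneg_of_nonpos hc.le hx.1, by
      simpa [mul_add] using mul_nonneg hc.le hx.2⟩) ψ
    (fun x hx => by
      have h1 := hx.1
      have h2 := hx.2
      rw [hψ]
      linarith) ![1, 0] (d := 2) (by norm_num)
  have hset1 : {x : Fin 2 → ℝ | x ∈ {x : Fin 2 → ℝ | x 1 ≤ 0 ∧ 0 ≤ x 0 + x 1} ∧ ψ x ≤ 1} =
      {x : Fin (1 + 1) → ℝ | x (Fin.last 1) ≤ 0 ∧
        Fin.init x + x (Fin.last 1) • ![1] ∈ {x : Fin 1 → ℝ | 0 ≤ x 0} ∧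
        φ (Fin.init x + x (Fin.last 1) • ![1]) ≤ 1 + 2 * x (Fin.last 1)} := by
    ext x
    simp only [Set.mem_ofPred_eq, hφ, hψ, Pi.add_apply, Pi.smul_apply, Fin.init,
      Fin.castSucc_zero, smul_eq_mul, Matrix.cons_val, mul_one]
    change _ ↔ x 1 ≤ 0 ∧ 0 ≤ x 0 + x 1 ∧ 3 * (x 0 + x 1) ≤ 1 + 2 * x 1
    grind
  rw [hset1, hone] at htwo
  have hset2 : nefPolytope 2 = {x : Fin (2 + 1) → ℝ | x (Fin.last 2) ≤ 0 ∧
        Fin.init x + x (Fin.last 2) • ![1, 0] ∈ {x : Fin 2 → ℝ | x 1 ≤ 0 ∧ 0 ≤ x 0 + x 1} ∧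
        ψ (Fin.init x + x (Fin.last 2) • ![1, 0]) ≤ 1 + 2 * x (Fin.last 2)} := by
    ext x
    refine (and_congr mem_nefCone_two (by rw [interR_antiKR_two])).trans
      (b := (x 1 ≤ 0 ∧ x 2 ≤ 0 ∧ 0 ≤ x 0 + x 1 + x 2) ∧ 3 * x 0 + x 1 + x 2 ≤ 1) ?_
    simp only [Set.mem_ofPred_eq, hψ, Pi.add_apply, Pi.smul_apply, Fin.init, Fin.castSucc_zero,
      smul_eq_mul, Matrix.cons_val, mul_one, mul_zero, add_zero]
    change _ ↔ x 2 ≤ 0 ∧ (x 1 ≤ 0 ∧ 0 ≤ x 0 + x 2 + x 1) ∧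
      3 * (x 0 + x 2) + x 1 ≤ 1 + 2 * x 2
    grind
  rw [hset2, htwo, ← ENNReal.ofReal_mul (by norm_num), ← ENNReal.ofReal_mul (by norm_num)]
  norm_num

theorem degree_nonneg_two {x : Fin 3 → ℝ} (hx : x ∈ NefCone 2) : 0 ≤ interR (antiKR 2) x := by
  rw [mem_nefCone_two] at hx
  rw [interR_antiKR_two]
  linarith

theorem degree_nonneg_of_sum_classes {n : ℕ} (hn : n ≤ 7) {c : ℤ} (hc : 0 < c)
    (hsum : (classes n).sum = c • antiK n) (x : Fin (n + 1) → ℝ) (hx : x ∈ NefCone n) :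
    0 ≤ interR (antiKR n) x :=
  degree_nonneg (fun _ hE => (mem_classes hn).1 hE) hc hsum hx

theorem volume_nefPolytope_seven : volume (nefPolytope 7) = ENNReal.ofReal (1 / 240) := by
  have h3 := volume_nefPolytope_succ (n := 2) (by norm_num) (by decide +kernel)
    (by decide +kernel) (fun _ => degree_nonneg_two) (by decide +kernel) (by decide +kernel)
    (by norm_num) volume_nefPolytope_two
  rw [show (classes (2 + 1)).length = 6 by decide +kernel] at h3
  have h4 := volume_nefPolytope_succ (n := 3) (by norm_num) (by decide +kernel)
    (by decide +kernel) (degree_nonneg_of_sum_classes (c := 1) (by norm_num) (by norm_num)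
    (by decide +kernel)) (by decide +kernel) (by decide +kernel) (by norm_num) h3
  rw [show (classes (3 + 1)).length = 10 by decide +kernel] at h4
  have h5 := volume_nefPolytope_succ (n := 4) (by norm_num) (by decide +kernel)
    (by decide +kernel) (degree_nonneg_of_sum_classes (c := 2) (by norm_num) (by norm_num)
    (by decide +kernel)) (by decide +kernel) (by decide +kernel) (by norm_num) h4
  rw [show (classes (4 + 1)).length = 16 by decide +kernel] at h5
  have h6 := volume_nefPolytope_succ (n := 5) (by norm_num) (by decide +kernel)
    (by decide +kernel) (degree_nonneg_of_sum_classes (c := 4) (by norm_num) (by norm_num)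
    (by decide +kernel)) (by decide +kernel) (by decide +kernel) (by norm_num) h5
  rw [show (classes (5 + 1)).length = 27 by decide +kernel] at h6
  have h7 := volume_nefPolytope_succ (n := 6) (by norm_num) (by decide +kernel)
    (by decide +kernel) (degree_nonneg_of_sum_classes (c := 9) (by norm_num) (by norm_num)
    (by decide +kernel)) (by decide +kernel) (by decide +kernel) (by norm_num) h6
  rw [show (classes (6 + 1)).length = 56 by decide +kernel] at h7
  rw [h7]
  norm_num

theorem alpha_S7 :
    8 * (volume {x : Fin (7 + 1) → ℝ | x ∈ NefCone 7 ∧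
      0 ≤ interR (antiKR 7) x ∧ interR (antiKR 7) x ≤ 1}).toReal = 1 / 30 := by
  have hset : {x : Fin (7 + 1) → ℝ | x ∈ NefCone 7 ∧
      0 ≤ interR (antiKR 7) x ∧ interR (antiKR 7) x ≤ 1} = nefPolytope 7 := by
    ext x
    refine and_congr_right fun hx => and_iff_right ?_
    exact degree_nonneg_of_sum_classes (c := 28) le_rfl (by norm_num) (by decide +kernel) x hx
  rw [hset, volume_nefPolytope_seven, ENNReal.toReal_ofReal (by norm_num)]
  norm_num
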